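/- arXiv:1107.0742 — 4 statements merged into one kernel-verified Lean document; each statement's English description precedes it below -/
import Mathlib

section
/- Let τ be a Hopf algebra automorphism of H with τ^m = Id, and let (V,ρ) be a finite-dimensional left H-module with character χ. If ζ_m is a primitive m-th root of unity in k, then ν_m(χ,τ) ∈ ℤ[ζ_m]; in particular, the twisted Frobenius–Schur indicator is a cyclotomic integer. -/
open TensorProduct

noncomputable section

universe u

variable (k : Type u) [Field k]

/-- `twistedMulMap τ n : h ↦ Σ h₁ · τ(h₂) · ⋯ · τⁿ(h_{n+1})`, the product of the `n+1`
Sweedler factors of the iterated comultiplication with the twist `τ` applied progressively. -/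
def twistedMulMap (H : Type u) [Ring H] [HopfAlgebra k H] (τ : H →ₗ[k] H) :
    ℕ → (H →ₗ[k] H)
  | 0 => LinearMap.id
  | n + 1 => LinearMap.mul' k H ∘ₗ TensorProduct.map LinearMap.id (τ ∘ₗ twistedMulMap H τ n)
      ∘ₗ Coalgebra.comul (R := k)

/-- `powLM τ n` is the `n`-fold composition `τ ∘ ⋯ ∘ τ`. -/
def powLM (H : Type u) [Ring H] [HopfAlgebra k H] (τ : H →ₗ[k] H) : ℕ → (H →ₗ[k] H)
  | 0 => LinearMap.id
  | n + 1 => τ ∘ₗ powLM H τ n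

section ConvolutionMatrices

open WithConv

variable {k} {H ι : Type*} [Ring H] [Bialgebra k H] [Fintype ι] [DecidableEq ι]

/-- Evaluation at `x`, as a linear functional on the convolution algebra `H^*`. -/
def convEval (x : H) : WithConv (H →ₗ[k] k) →ₗ[k] k :=
  LinearMap.applyₗ x ∘ₗ (WithConv.linearEquiv k (H →ₗ[k] k)).toLinearMap

lemma convEval_apply (x : H) (φ : WithConv (H →ₗ[k] k)) : convEval x φ = φ.ofConv x := rfl

/-- The matrix, over the convolution algebra `H^*`, of coefficient functionals of a
matrix-valued linear map. -/
def coeffMatrix (F : H →ₗ[k] Matrix ι ι k) : Matrix ι ι (WithConv (H →ₗ[k] k)) :=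
  Matrix.of fun i j => toConv (Matrix.entryLinearMap k k i j ∘ₗ F)

omit [Fintype ι] [DecidableEq ι] in
lemma convEval_coeffMatrix (x : H) (F : H →ₗ[k] Matrix ι ι k) (i j : ι) :
    convEval x (coeffMatrix F i j) = F x i j := rfl

lemma coeffMatrix_mul (F G : WithConv (H →ₗ[k] Matrix ι ι k)) :
    coeffMatrix (F * G).ofConv = coeffMatrix F.ofConv * coeffMatrix G.ofConv := by
  refine Matrix.ext fun i j => WithConv.ext (LinearMap.ext fun x => ?_)
  change convEval x (coeffMatrix (F * G).ofConv i j) =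
    convEval x ((coeffMatrix F.ofConv * coeffMatrix G.ofConv) i j)
  rw [Matrix.mul_apply, map_sum, convEval_coeffMatrix]
  simp only [convEval_apply, LinearMap.convMul_def, LinearMap.comp_apply]
  induction Coalgebra.comul (R := k) x using TensorProduct.induction_on with
  | zero => simp
  | add u v hu hv => simp [hu, hv, Finset.sum_add_distrib]
  | tmul u v => simp [coeffMatrix, Matrix.mul_apply]

omit [Fintype ι] [DecidableEq ι] in
lemma convEval_mul_comm {Λ : H}
    (hΛ : TensorProduct.comm k H H (Coalgebra.comul (R := k) Λ) = Coalgebra.comul (R := k) Λ)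
    (φ ψ : WithConv (H →ₗ[k] k)) : convEval Λ (φ * ψ) = convEval Λ (ψ * φ) := by
  rw [convEval_apply, convEval_apply, LinearMap.convMul_def, LinearMap.convMul_def]
  simp only [LinearMap.comp_apply]
  conv_lhs => rw [← hΛ]
  induction Coalgebra.comul (R := k) Λ using TensorProduct.induction_on with
  | zero => simp
  | add u v hu hv => simp [hu, hv]
  | tmul u v => simp [mul_comm]

/-- Precomposition with a comultiplicative, counit-preserving map, as an endomorphism of the
convolution algebra. -/
def convPrecomp (τ : H →ₗ[k] H)
    (hΔ : Coalgebra.comul (R := k) ∘ₗ τ = TensorProduct.map τ τ ∘ₗ Coalgebra.comul (R := k))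
    (hε : Coalgebra.counit (R := k) ∘ₗ τ = Coalgebra.counit (R := k)) :
    WithConv (H →ₗ[k] k) →* WithConv (H →ₗ[k] k) where
  toFun φ := toConv (φ.ofConv ∘ₗ τ)
  map_one' := by
    rw [LinearMap.convOne_def, ofConv_toConv, LinearMap.comp_assoc, hε]
  map_mul' φ ψ := by
    simp only [LinearMap.convMul_def, ofConv_toConv, LinearMap.comp_assoc, hΔ,
      TensorProduct.map_comp]

/-- `tensorCoeff a n f g` is the `(f, g)` matrix coefficient of the tensor product of the
first `n` representations with coefficient matrices `a 0, a 1, …`. -/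
def tensorCoeff (a : ℕ → Matrix ι ι (WithConv (H →ₗ[k] k))) (n : ℕ) (f g : Fin n → ι) :
    WithConv (H →ₗ[k] k) :=
  (List.ofFn fun s : Fin n => a s (f s) (g s)).prod

omit [Fintype ι] [DecidableEq ι] in
lemma tensorCoeff_succ (a : ℕ → Matrix ι ι (WithConv (H →ₗ[k] k))) (n : ℕ)
    (f g : Fin (n + 1) → ι) :
    tensorCoeff a (n + 1) f g =
      a 0 (f 0) (g 0) * tensorCoeff (fun s => a (s + 1)) n (Fin.tail f) (Fin.tail g) := by
  simp [tensorCoeff, List.ofFn_succ, Fin.tail]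

omit [Fintype ι] [DecidableEq ι] in
lemma tensorCoeff_succ_last (a : ℕ → Matrix ι ι (WithConv (H →ₗ[k] k))) (n : ℕ)
    (f g : Fin (n + 1) → ι) :
    tensorCoeff a (n + 1) f g =
      tensorCoeff a n (Fin.init f) (Fin.init g) * a n (f (Fin.last n)) (g (Fin.last n)) := by
  simp only [tensorCoeff, List.ofFn_succ', List.concat_eq_append, List.prod_append,
    List.prod_singleton, Fin.init, Fin.val_castSucc, Fin.val_last]

omit [Fintype ι] [DecidableEq ι] in
/-- Convolution of coefficients of representations is again multiplicative. -/
lemma convEval_mul_mul {κ κ' : Type*} [Fintype κ] [Fintype κ']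
    {a : Matrix κ κ (WithConv (H →ₗ[k] k))} {b : Matrix κ' κ' (WithConv (H →ₗ[k] k))}
    (ha : ∀ x y i j, convEval (x * y) (a i j) = ∑ l, convEval x (a i l) * convEval y (a l j))
    (hb : ∀ x y i j, convEval (x * y) (b i j) = ∑ l, convEval x (b i l) * convEval y (b l j))
    (x y : H) (i j : κ) (f g : κ') :
    convEval (x * y) (a i j * b f g) =
      ∑ l, ∑ h, convEval x (a i l * b f h) * convEval y (a l j * b h g) := by
  simp only [convEval_apply, LinearMap.convMul_def, LinearMap.comp_apply, Bialgebra.comul_mul]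
    at ha hb ⊢
  induction Coalgebra.comul (R := k) x using TensorProduct.induction_on with
  | zero => simp
  | add u v hu hv => simp [hu, hv, add_mul, Finset.sum_add_distrib]
  | tmul u u' =>
    induction Coalgebra.comul (R := k) y using TensorProduct.induction_on with
    | zero => simp
    | add v w hv hw => simp [hv, hw, mul_add, Finset.sum_add_distrib]
    | tmul v v' =>
      simp only [Algebra.TensorProduct.tmul_mul_tmul, TensorProduct.map_tmul,
        LinearMap.mul'_apply, ha, hb, Finset.sum_mul_sum]
      refine Finset.sum_congr rfl fun l _ => Finset.sum_congr rfl fun h _ => ?_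
      ring

omit [DecidableEq ι] in
lemma convEval_mul_tensorCoeff (n : ℕ) (a : ℕ → Matrix ι ι (WithConv (H →ₗ[k] k)))
    (ha : ∀ s x y i j,
      convEval (x * y) (a s i j) = ∑ l, convEval x (a s i l) * convEval y (a s l j))
    (x y : H) (f g : Fin n → ι) :
    convEval (x * y) (tensorCoeff a n f g) =
      ∑ h, convEval x (tensorCoeff a n f h) * convEval y (tensorCoeff a n h g) := by
  induction n generalizing a x y with
  | zero => simp [tensorCoeff, convEval_apply]
  | succ n ih =>
    rw [← (Fin.consEquiv fun _ => ι).sum_comp, Fintype.sum_prod_type]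
    simp only [tensorCoeff_succ, Fin.consEquiv, Equiv.coe_fn_mk, Fin.cons_zero, Fin.tail_cons]
    exact convEval_mul_mul (b := Matrix.of (tensorCoeff (fun s => a (s + 1)) n)) (ha 0)
      (fun x y f g => ih _ (fun s => ha (s + 1)) x y f g) x y _ _ _ _

/-- An entry of a product of `n + 1` matrices is a sum over paths. -/
lemma list_prod_apply_eq_sum (n : ℕ) (a : ℕ → Matrix ι ι (WithConv (H →ₗ[k] k))) (i j : ι) :
    (List.ofFn fun s : Fin (n + 1) => a s).prod i j =
      ∑ g : Fin n → ι, tensorCoeff a (n + 1) (Fin.cons i g) (Fin.snoc g j) := by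
  induction n generalizing a i with
  | zero => simp [tensorCoeff, Fin.snoc]
  | succ n ih =>
    rw [List.ofFn_succ, List.prod_cons, Matrix.mul_apply,
      ← (Fin.consEquiv fun _ => ι).sum_comp, Fintype.sum_prod_type]
    refine Finset.sum_congr rfl fun l _ => ?_
    have := ih (fun s => a (s + 1)) l
    simp only [Fin.val_succ, Fin.val_zero, this, Finset.mul_sum]
    refine Finset.sum_congr rfl fun g _ => ?_
    rw [tensorCoeff_succ a (n + 1)]
    simp only [Fin.consEquiv, Equiv.coe_fn_mk, ← Fin.cons_snoc_eq_snoc_cons, Fin.cons_zero,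
      Fin.tail_cons]

lemma trace_list_prod_eq_sum (n : ℕ) (a : ℕ → Matrix ι ι (WithConv (H →ₗ[k] k))) :
    (List.ofFn fun s : Fin (n + 1) => a s).prod.trace =
      ∑ f : Fin (n + 1) → ι, tensorCoeff a (n + 1) f (f ∘ finRotate (n + 1)) := by
  rw [← (Fin.consEquiv fun _ => ι).sum_comp, Fintype.sum_prod_type, Matrix.trace]
  refine Finset.sum_congr rfl fun i _ => ?_
  rw [Matrix.diag_apply, list_prod_apply_eq_sum]
  refine Finset.sum_congr rfl fun g _ => ?_
  rw [Fin.snoc_eq_cons_rotate]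
  rfl

omit [Fintype ι] [DecidableEq ι] in
/-- If `Λ` is cocommutative and invariant under `σ`, and `σ` permutes the factors cyclically,
then the value at `Λ` is invariant under cyclic rotation of the indices. -/
lemma convEval_tensorCoeff_rotate {Λ : H}
    (hΛ : TensorProduct.comm k H H (Coalgebra.comul (R := k) Λ) = Coalgebra.comul (R := k) Λ)
    (n : ℕ) (a : ℕ → Matrix ι ι (WithConv (H →ₗ[k] k)))
    (σ : WithConv (H →ₗ[k] k) →* WithConv (H →ₗ[k] k))
    (hσΛ : ∀ φ, convEval Λ (σ φ) = convEval Λ φ)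
    (hσ : ∀ s i j, σ (a s i j) = a (s + 1) i j) (hper : a (n + 1) = a 0)
    (f g : Fin (n + 1) → ι) :
    convEval Λ (tensorCoeff a (n + 1) (f ∘ finRotate (n + 1)) (g ∘ finRotate (n + 1))) =
      convEval Λ (tensorCoeff a (n + 1) f g) := by
  have hinit : ∀ f : Fin (n + 1) → ι, Fin.init (f ∘ finRotate (n + 1)) = Fin.tail f := by
    intro f
    ext s
    simp [Fin.init, Fin.tail]
  have hmap : ∀ f g : Fin n → ι, σ (tensorCoeff a n f g) =
      tensorCoeff (fun s => a (s + 1)) n f g := by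
    intro f g
    simp only [tensorCoeff, map_list_prod, List.map_ofFn, Function.comp_def, hσ]
  rw [← hσΛ, tensorCoeff_succ_last, map_mul, hσ, hper, hinit, hinit, hmap,
    convEval_mul_comm hΛ, tensorCoeff_succ]
  simp

/-- The coefficient matrix of `F ∘ twistedMulMap τ n` is the product of the coefficient matrices
of the twists of `F`. -/
lemma coeffMatrix_comp_twistedMulMap {H : Type u} [Ring H] [HopfAlgebra k H] (τ : H →ₐ[k] H)
    (n : ℕ) (F : H →ₐ[k] Matrix ι ι k) :
    coeffMatrix (F.toLinearMap ∘ₗ twistedMulMap k H τ.toLinearMap n) =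
      (List.ofFn fun s : Fin (n + 1) =>
        coeffMatrix (F.toLinearMap ∘ₗ (τ.toLinearMap ^ (s : ℕ) : Module.End k H))).prod := by
  induction n generalizing F with
  | zero => simp [twistedMulMap, Module.End.one_eq_id]
  | succ n ih =>
    have h := LinearMap.algHom_comp_convMul_distrib F (toConv (LinearMap.id : H →ₗ[k] H))
      (toConv (τ.toLinearMap ∘ₗ twistedMulMap k H τ.toLinearMap n))
    have h' : F.toLinearMap ∘ₗ twistedMulMap k H τ.toLinearMap (n + 1) =
      (toConv F.toLinearMap * toConv ((F.comp τ).toLinearMap ∘ₗ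
        twistedMulMap k H τ.toLinearMap n)).ofConv := h
    rw [h', coeffMatrix_mul, ofConv_toConv, ofConv_toConv, ih, List.ofFn_succ (n := n + 1),
      List.prod_cons]
    congr 3
    refine funext fun s => ?_
    rw [Fin.val_succ, pow_succ']
    rfl

end ConvolutionMatrices

lemma finRotate_pow_card (n : ℕ) : finRotate (n + 1) ^ (n + 1) = 1 := by
  have h : ∀ (l : ℕ) (i : Fin (n + 1)), (finRotate (n + 1) ^ l) i = i + l • 1 := by
    intro l
    induction l with
    | zero => simp
    | succ l ih => intro i; simp [pow_succ', ih, add_assoc, succ_nsmul]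
  refine Equiv.ext fun i => ?_
  have h0 : (n + 1) • (1 : Fin (n + 1)) = 0 := by
    simpa using card_nsmul_eq_zero (x := (1 : Fin (n + 1)))
  rw [h, h0, add_zero, Equiv.Perm.one_apply]

/-- If an idempotent matrix `P` commutes with `C` and `C ^ m = 1`, the trace of `P * C` lies in
`ℤ[ζ]`. -/
lemma trace_idempotent_mul_mem_adjoin {K κ : Type*} [Field K] [IsAlgClosed K] [Fintype κ]
    [DecidableEq κ] {m : ℕ} (hm : 0 < m) {ζ : K} (hζ : IsPrimitiveRoot ζ m) {P C : Matrix κ κ K}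
    (hP : P * P = P) (hPC : Commute P C) (hC : C ^ m = 1) :
    (P * C).trace ∈ Algebra.adjoin ℤ ({ζ} : Set K) := by
  have : NeZero m := ⟨hm.ne'⟩
  have hpow : (P * C) ^ (m + 1) = P * C := by
    rw [hPC.mul_pow, IsIdempotentElem.pow_succ_eq m hP, pow_succ C, hC, one_mul]
  rw [Matrix.trace_eq_sum_roots_charpoly]
  refine multiset_sum_mem (S := Algebra.adjoin ℤ ({ζ} : Set K)) _ fun μ hμ => ?_
  have hspec : μ ∈ spectrum K (P * C) :=
    Matrix.mem_spectrum_iff_isRoot_charpoly.2 (Polynomial.isRoot_of_mem_roots hμ)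
  have h0 : μ ^ (m + 1) - μ = 0 := by
    have hmem := spectrum.subset_polynomial_aeval (P * C)
      (Polynomial.X ^ (m + 1) - Polynomial.X : Polynomial K) ⟨μ, hspec, rfl⟩
    have : Nontrivial (Matrix κ κ K) := by
      by_contra h
      rw [not_nontrivial_iff_subsingleton] at h
      exact absurd hspec (by rw [spectrum.of_subsingleton]; simp)
    simpa [hpow, spectrum.zero_eq] using hmem
  have h1 : μ * (μ ^ m - 1) = 0 := by rw [← h0]; ring
  rcases mul_eq_zero.1 h1 with h | h
  · exact h ▸ zero_mem _
  · obtain ⟨i, -, rfl⟩ := hζ.eq_pow_of_pow_eq_one (sub_eq_zero.1 h)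
    exact Subalgebra.pow_mem _ (Algebra.self_mem_adjoin_singleton ℤ ζ) i

/-- **Theorem.** Let `H` be a finite-dimensional semisimple Hopf algebra over an algebraically
closed field `k` of characteristic `0` with normalized two-sided integral `Λ`, let `τ` be a Hopf
algebra automorphism of `H` with `τ^m = Id` (`m ≥ 1`), and let `(V, ρ)` be a finite-dimensional
`H`-module with character `χ = tr ∘ ρ`.  If `ζ` is a primitive `m`-th root of unity in `k`, then
the `m`-th twisted Frobenius–Schur indicator
`ν_m(χ, τ) = Σ χ(Λ₁ τ(Λ₂) ⋯ τ^{m-1}(Λ_m))` lies in `ℤ[ζ]`: it is a cyclotomic integer. -/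
theorem twisted_FS_indicator_mem_cyclotomic_integers
    (H V : Type u) [Ring H] [HopfAlgebra k H]
    [IsAlgClosed k] [CharZero k] [FiniteDimensional k H] [IsSemisimpleRing H]
    [AddCommGroup V] [Module k V] [FiniteDimensional k V]
    (Λ : H)
    (hΛleft : ∀ a : H, a * Λ = Coalgebra.counit (R := k) a • Λ)
    (hΛright : ∀ a : H, Λ * a = Coalgebra.counit (R := k) a • Λ)
    (hΛone : Coalgebra.counit (R := k) Λ = 1)
    (hΛcc : TensorProduct.comm k H H (Coalgebra.comul (R := k) Λ) = Coalgebra.comul (R := k) Λ)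
    (m : ℕ) (hm : 0 < m)
    (τ : H →ₗ[k] H)
    (hτmul : ∀ a b : H, τ (a * b) = τ a * τ b) (hτone : τ 1 = 1)
    (hτcomul : Coalgebra.comul (R := k) ∘ₗ τ =
      TensorProduct.map τ τ ∘ₗ Coalgebra.comul (R := k))
    (hτcounit : Coalgebra.counit (R := k) ∘ₗ τ = Coalgebra.counit (R := k))
    (hτord : powLM k H τ m = LinearMap.id)
    (ρ : H →ₐ[k] Module.End k V)
    (ζ : k) (hζ : IsPrimitiveRoot ζ m) :
    LinearMap.trace k V (ρ (twistedMulMap k H τ (m - 1) Λ)) ∈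
      Algebra.adjoin ℤ ({ζ} : Set k) := by
  obtain ⟨n, rfl⟩ : ∃ n, m = n + 1 := ⟨m - 1, by omega⟩
  let t : H →ₐ[k] H := AlgHom.ofLinearMap τ hτone hτmul
  have ht : t.toLinearMap = τ := rfl
  have hpowLM : ∀ s, powLM k H τ s = (τ ^ s : Module.End k H) := by
    intro s
    induction s with
    | zero => rfl
    | succ s ih => rw [powLM, ih, pow_succ']; rfl
  have hτpow : (τ ^ (n + 1) : Module.End k H) = 1 := by rw [← hpowLM, hτord]; rfl
  have hτΛ : τ Λ = Λ := by
    have h1 := hΛright (τ Λ)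
    have h2 : Λ = τ ((τ ^ n : Module.End k H) Λ) := by
      rw [← Module.End.mul_apply, ← pow_succ', hτpow, Module.End.one_apply]
    have hε : ∀ x, Coalgebra.counit (R := k) (τ x) = Coalgebra.counit (R := k) x :=
      fun x => LinearMap.congr_fun hτcounit x
    have hε1 : Coalgebra.counit (R := k) ((τ ^ n : Module.End k H) Λ) = 1 := by
      rw [← hε, ← h2, hΛone]
    rw [hε, hΛone, one_smul] at h1
    conv_lhs at h1 => lhs; rw [h2]
    rwa [← hτmul, hΛleft, hε1, one_smul] at h1
  let b := Module.finBasis k V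
  let F : H →ₐ[k] Matrix _ _ k := (LinearMap.toMatrixAlgEquiv b).toAlgHom.comp ρ
  let a : ℕ → Matrix _ _ (WithConv (H →ₗ[k] k)) := fun s =>
    coeffMatrix (F.toLinearMap ∘ₗ (τ ^ s : Module.End k H))
  have ha : ∀ s x y i j,
      convEval (x * y) (a s i j) = ∑ l, convEval x (a s i l) * convEval y (a s l j) := by
    intro s x y i j
    have hs : (τ ^ s : Module.End k H) (x * y) =
        (τ ^ s : Module.End k H) x * (τ ^ s : Module.End k H) y := by
      induction s with
      | zero => rfl
      | succ s ih => simp only [pow_succ', Module.End.mul_apply, ih, hτmul]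
    simp only [a, convEval_coeffMatrix, LinearMap.comp_apply, hs, AlgHom.toLinearMap_apply,
      map_mul, Matrix.mul_apply]
  have hasucc : ∀ s, a (s + 1) = coeffMatrix (F.toLinearMap ∘ₗ (τ ^ s * τ : Module.End k H)) :=
    fun s => by simp only [a, pow_succ]
  let P : Matrix (Fin (n + 1) → Fin (Module.finrank k V))
      (Fin (n + 1) → Fin (Module.finrank k V)) k :=
    Matrix.of fun f g => convEval Λ (tensorCoeff a (n + 1) f g)
  let E : Equiv.Perm (Fin (n + 1) → Fin (Module.finrank k V)) :=
    (finRotate (n + 1)).symm.arrowCongr (Equiv.refl _)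
  have hE : ∀ f, E f = f ∘ finRotate (n + 1) := fun f => rfl
  have hEpow : E ^ (n + 1) = 1 := by
    have h : ∀ (l : ℕ) f, (E ^ l) f = f ∘ (finRotate (n + 1) ^ l : Equiv.Perm _) := by
      intro l
      induction l with
      | zero => intro f; rfl
      | succ l ih => intro f; rw [pow_succ', Equiv.Perm.mul_apply, ih, hE, pow_succ]; rfl
    ext f : 1
    rw [h, finRotate_pow_card]
    rfl
  let C := Matrix.permMatrixHom (R := k) E
  have hC : C = (E⁻¹).permMatrix k := rfl
  have hPC : P * C = P.submatrix id E := by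
    rw [hC, PEquiv.mul_toMatrix_toPEquiv]
    rfl
  have hCP : C * P = P.submatrix E.symm id := by
    rw [hC, PEquiv.toMatrix_toPEquiv_mul]
    rfl
  have hrot : ∀ f g, P (E f) (E g) = P f g := fun f g =>
    convEval_tensorCoeff_rotate hΛcc n a (convPrecomp τ hτcomul hτcounit)
      (fun φ => congrArg φ.ofConv hτΛ)
      (fun s i j => by rw [hasucc]; rfl)
      (by simp only [a, hτpow, pow_zero]) f g
  have htrace : LinearMap.trace k V (ρ (twistedMulMap k H τ n Λ)) = (P * C).trace := by
    have h := congrArg (fun M => convEval Λ (Matrix.trace M))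
      (coeffMatrix_comp_twistedMulMap t n F)
    simp only [ht] at h
    rw [trace_list_prod_eq_sum n a, map_sum, Matrix.trace, map_sum] at h
    rw [LinearMap.trace_eq_matrix_trace k b, hPC]
    exact h
  rw [Nat.add_sub_cancel, htrace]
  refine trace_idempotent_mul_mem_adjoin hm hζ ?_ ?_ ?_
  · ext f g
    have h := convEval_mul_tensorCoeff (n + 1) a ha Λ Λ f g
    rw [hΛleft, hΛone, one_smul] at h
    rw [Matrix.mul_apply]
    exact h.symm
  · rw [Commute, SemiconjBy, hPC, hCP]
    ext f g
    simpa using (hrot (E.symm f) g)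
  · rw [← map_pow, hEpow, map_one]

end
end

section
/- Let τ be a Hopf algebra automorphism of H with τ² = Id, and let (V,ρ) be an irreducible finite-dimensional left H-module with character χ. Then the second twisted Frobenius–Schur indicator ν₂(χ,τ) equals 0, 1, or −1. -/
open TensorProduct

noncomputable section

universe u

variable (k : Type u) [Field k]

/-- The transpose `f ↦ fᵗ = Ψ⁻¹ ∘ f†` of maps `V† → V`, where `Ψ : V ≃ V**` is evaluation
and `f†` is the usual dual map. -/
def transposeMap (V : Type u) [AddCommGroup V] [Module k V] [FiniteDimensional k V] :
    (Module.Dual k V →ₗ[k] V) →ₗ[k] (Module.Dual k V →ₗ[k] V) :=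
  LinearMap.llcomp k (Module.Dual k V) (Module.Dual k (Module.Dual k V)) V
      (Module.evalEquiv k V).symm.toLinearMap ∘ₗ Module.Dual.transpose (R := k)

/-- The space `Hom_H(V†, V)` of `H`-module maps from the twisted dual `V†` (the dual space
of `V` with the `H`-action `(h · f)(v) = f(T(h) · v)`, `T = τ ∘ S`) to `V`. -/
def homHSub (H V : Type u) [Ring H] [HopfAlgebra k H] [AddCommGroup V] [Module k V]
    (τ : H →ₗ[k] H) (ρ : H →ₐ[k] Module.End k V) :
    Submodule k (Module.Dual k V →ₗ[k] V) where
  carrier := {f | ∀ h : H,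
    ρ h ∘ₗ f = f ∘ₗ (ρ (τ (HopfAlgebra.antipode (R := k) h))).dualMap}
  add_mem' := by
    intro f g hf hg h
    simp only [LinearMap.comp_add, LinearMap.add_comp, hf h, hg h]
  zero_mem' := by
    intro h
    simp
  smul_mem' := by
    intro c f hf h
    simp only [LinearMap.comp_smul, LinearMap.smul_comp, hf h]

section FrobeniusSchur

variable {k}
variable {H V D : Type*}
variable [AddCommGroup V] [Module k V]

/-- Composing `A ⊗ B` with the flip turns the trace into the trace of `A ∘ B`. -/
theorem trace_comm_comp_map [FiniteDimensional k V] (A B : Module.End k V) :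
    LinearMap.trace k (V ⊗[k] V)
      ((TensorProduct.comm k V V).toLinearMap ∘ₗ TensorProduct.map A B) =
      LinearMap.trace k V (A ∘ₗ B) := by
  have hsurj : Function.Surjective (dualTensorHom k V V) := (dualTensorHomEquiv k V V).surjective
  obtain ⟨a, rfl⟩ := hsurj A
  obtain ⟨b, rfl⟩ := hsurj B
  induction a with
  | zero => simp
  | add x y hx hy =>
    simp only [map_add, TensorProduct.map_add_left, LinearMap.comp_add, LinearMap.add_comp, hx, hy]
  | tmul f m =>
    induction b with
    | zero => simp
    | add x y hx hy =>
      simp only [map_add, TensorProduct.map_add_right, LinearMap.comp_add, hx, hy]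
    | tmul g n =>
      have h : (TensorProduct.comm k V V).toLinearMap ∘ₗ
          TensorProduct.map (dualTensorHom k V V (f ⊗ₜ m)) (dualTensorHom k V V (g ⊗ₜ n)) =
          dualTensorHom k (V ⊗[k] V) (V ⊗[k] V)
            (TensorProduct.dualDistrib k V V (f ⊗ₜ g) ⊗ₜ (n ⊗ₜ m)) := by
        ext x y
        simp [smul_smul, mul_comm]
      rw [h, comp_dualTensorHom]
      simp

/-- An involution commuting with an idempotent of rank at most one has trace `0`, `1` or `-1`
on its range. -/
theorem trace_involution_comp_idempotent [FiniteDimensional k V] [CharZero k] (s P : Module.End k V)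
    (hs : ∀ x, s (s x) = x) (hP : ∀ x, P (P x) = P x) (hsP : ∀ x, s (P x) = P (s x))
    (hrank : Module.finrank k (LinearMap.range P) ≤ 1) :
    LinearMap.trace k V (s ∘ₗ P) = 0 ∨ LinearMap.trace k V (s ∘ₗ P) = 1 ∨
      LinearMap.trace k V (s ∘ₗ P) = -1 := by
  have hproj : LinearMap.IsProj (LinearMap.range P) P :=
    ⟨fun x => ⟨x, rfl⟩, by rintro _ ⟨x, rfl⟩; exact hP x⟩
  have htr := hproj.trace
  rcases Nat.le_one_iff_eq_zero_or_eq_one.mp hrank with h0 | h1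
  · left
    rw [Submodule.finrank_eq_zero, LinearMap.range_eq_bot] at h0
    simp [h0]
  · right
    obtain ⟨⟨t, ht⟩, ht0, hspan⟩ := finrank_eq_one_iff'.mp h1
    have ht0' : t ≠ 0 := fun h => ht0 (Subtype.ext h)
    have hst : s t ∈ LinearMap.range P := by
      obtain ⟨x, rfl⟩ := ht
      exact ⟨s x, (hsP x).symm⟩
    obtain ⟨c, hc⟩ := hspan ⟨s t, hst⟩
    replace hc : c • t = s t := congrArg Subtype.val hc
    have hcc : c * c = 1 := by
      have h : (c * c) • t = (1 : k) • t := by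
        rw [mul_smul, hc, ← map_smul, hc, hs, one_smul]
      exact smul_left_injective k ht0' h
    have hsc : s ∘ₗ P = c • P := by
      ext x
      obtain ⟨a, ha⟩ := hspan ⟨P x, x, rfl⟩
      replace ha : a • t = P x := congrArg Subtype.val ha
      simp only [LinearMap.comp_apply, LinearMap.smul_apply]
      rw [← ha, map_smul, ← hc, smul_comm]
    rw [hsc, map_smul, htr, h1]
    simpa using mul_self_eq_one_iff.mp hcc

/-- A space of linear maps between spaces of the same dimension in which every nonzero map is
surjective has dimension at most one over an algebraically closed field. -/
theorem finrank_le_one_of_forall_eq_zero_or_range_eq_top [FiniteDimensional k V] [IsAlgClosed k] [Nontrivial V]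
    [AddCommGroup D] [Module k D] [FiniteDimensional k D]
    (hDV : Module.finrank k D = Module.finrank k V) (I : Submodule k (D →ₗ[k] V))
    (hI : ∀ f ∈ I, f = 0 ∨ LinearMap.range f = ⊤) : Module.finrank k I ≤ 1 := by
  by_cases hbot : I = ⊥
  · rw [hbot, finrank_bot]
    exact zero_le_one
  obtain ⟨f, hf, hf0⟩ := Submodule.exists_mem_ne_zero_of_ne_bot hbot
  have hsurj := LinearMap.range_eq_top.mp ((hI f hf).resolve_left hf0)
  have hinj := (LinearMap.injective_iff_surjective_of_finrank_eq_finrank hDV).mpr hsurj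
  let e := LinearEquiv.ofBijective f ⟨hinj, hsurj⟩
  refine finrank_le_one (⟨f, hf⟩ : I) ?_
  rintro ⟨g, hg⟩
  obtain ⟨c, hc⟩ := Module.End.exists_eigenvalue (g ∘ₗ e.symm.toLinearMap)
  obtain ⟨v, hv⟩ := hc.exists_hasEigenvector
  have hgv : g (e.symm v) = c • v := hv.apply_eq_smul
  refine ⟨c, Subtype.ext ?_⟩
  have hmem : g - c • f ∈ I := I.sub_mem hg (I.smul_mem c hf)
  have hker : (g - c • f) (e.symm v) = 0 := by
    have : f (e.symm v) = v := e.apply_symm_apply v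
    rw [LinearMap.sub_apply, LinearMap.smul_apply, this, hgv, sub_self]
  rcases hI _ hmem with h | h
  · exact (sub_eq_zero.mp h).symm
  · have hinj' := (LinearMap.injective_iff_surjective_of_finrank_eq_finrank hDV).mpr
      (LinearMap.range_eq_top.mp h)
    have hv0 : e.symm v = 0 := hinj' (by rw [hker, map_zero])
    exact absurd (e.symm.map_eq_zero_iff.mp hv0) hv.2

variable (k V) in
/-- The equivalence `V ⊗ V ≃ Hom(V*, V)` sending `v ⊗ w` to `φ ↦ φ v • w`. -/
def tensorEquivDualHom [FiniteDimensional k V] : V ⊗[k] V ≃ₗ[k] (Module.Dual k V →ₗ[k] V) :=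
  (TensorProduct.congr (Module.evalEquiv k V) (LinearEquiv.refl k V)).trans
    (dualTensorHomEquiv k (Module.Dual k V) V)

@[simp]
theorem tensorEquivDualHom_tmul [FiniteDimensional k V] (v w : V) (φ : Module.Dual k V) :
    tensorEquivDualHom k V (v ⊗ₜ w) φ = φ v • w := by
  simp [tensorEquivDualHom]

theorem tensorEquivDualHom_map [FiniteDimensional k V] (A B : Module.End k V) (t : V ⊗[k] V) :
    tensorEquivDualHom k V (TensorProduct.map A B t) =
      B ∘ₗ tensorEquivDualHom k V t ∘ₗ A.dualMap := by
  induction t with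
  | zero => simp
  | add x y hx hy => simp only [map_add, hx, hy, LinearMap.add_comp, LinearMap.comp_add]
  | tmul v w => ext φ; simp

variable [Ring H] [HopfAlgebra k H]

/-- The Hopf algebra identity `∑ S(h₁) h₂ ⊗ h₃ = 1 ⊗ h`. -/
theorem sum_antipode_tmul_one_mul_comul (h : H) {ι : Type*} (r : Coalgebra.Repr k h ι) :
    ∑ i ∈ r.index, (HopfAlgebra.antipode k (r.left i) ⊗ₜ[k] (1 : H)) *
      Coalgebra.comul (R := k) (r.right i) = 1 ⊗ₜ h := by
  let m : H ⊗[k] H →ₗ[k] H := LinearMap.mul' k H ∘ₗ (HopfAlgebra.antipode k).rTensor H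
  let M : H ⊗[k] (H ⊗[k] H) →ₗ[k] H ⊗[k] H :=
    m.rTensor H ∘ₗ (TensorProduct.assoc k H H H).symm.toLinearMap
  have hM (a : H) (y : H ⊗[k] H) :
      M (a ⊗ₜ y) = (HopfAlgebra.antipode k a ⊗ₜ[k] (1 : H)) * y := by
    induction y with
    | zero => simp
    | add x y hx hy => rw [TensorProduct.tmul_add, map_add, hx, hy, mul_add]
    | tmul b c => simp [M, m]
  have h1 : ∑ i ∈ r.index, (HopfAlgebra.antipode k (r.left i) ⊗ₜ[k] (1 : H)) *
      Coalgebra.comul (R := k) (r.right i) =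
      M ((Coalgebra.comul (R := k)).lTensor H (Coalgebra.comul (R := k) h)) := by
    rw [← r.eq]
    simp only [map_sum, LinearMap.lTensor_tmul, hM]
  have hm : m ∘ₗ Coalgebra.comul (R := k) = Algebra.linearMap k H ∘ₗ Coalgebra.counit (R := k) :=
    HopfAlgebra.mul_antipode_rTensor_comul
  rw [h1, ← Coalgebra.coassoc_apply]
  simp only [M, LinearMap.comp_apply, LinearEquiv.coe_coe, LinearEquiv.symm_apply_apply]
  rw [← LinearMap.comp_apply, ← LinearMap.rTensor_comp, hm, LinearMap.rTensor_comp,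
    LinearMap.comp_apply, Coalgebra.rTensor_counit_comul]
  simp

/-- The action of `H ⊗ H` on `V ⊗ V` given by representations `ρ` and `σ`. -/
def tensorAction (ρ σ : H →ₐ[k] Module.End k V) : H ⊗[k] H →ₐ[k] Module.End k (V ⊗[k] V) :=
  Module.endTensorEndAlgHom.comp (Algebra.TensorProduct.map ρ σ)

@[simp]
theorem tensorAction_tmul (ρ σ : H →ₐ[k] Module.End k V) (a b : H) :
    tensorAction ρ σ (a ⊗ₜ b) = TensorProduct.map (ρ a) (σ b) := by
  rfl

/-- On an invariant tensor, acting on the right factor by `h` is acting on the left factor by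
the antipode of `h`. -/
theorem tensorAction_one_tmul_of_invariant (ρ σ : H →ₐ[k] Module.End k V) (t : V ⊗[k] V)
    (ht : ∀ h : H, tensorAction ρ σ (Coalgebra.comul (R := k) h) t =
      Coalgebra.counit (R := k) h • t) (h : H) :
    tensorAction ρ σ (1 ⊗ₜ h) t = tensorAction ρ σ (HopfAlgebra.antipode k h ⊗ₜ 1) t := by
  let r := Coalgebra.Repr.arbitrary k h
  have hS : HopfAlgebra.antipode k h ⊗ₜ[k] (1 : H) = ∑ i ∈ r.index,
      Coalgebra.counit (R := k) (r.right i) • (HopfAlgebra.antipode k (r.left i) ⊗ₜ[k] (1 : H)) := by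
    have hr := Coalgebra.sum_tmul_counit_eq r
    apply_fun fun y => (TensorProduct.rid k H) y at hr
    simp only [map_sum, TensorProduct.rid_tmul, one_smul] at hr
    simp only [TensorProduct.smul_tmul', ← TensorProduct.sum_tmul, ← map_smul, ← map_sum, hr]
  rw [← sum_antipode_tmul_one_mul_comul h r, hS]
  simp only [map_sum, map_mul, LinearMap.sum_apply, Module.End.mul_apply, ht, map_smul,
    LinearMap.smul_apply]

/-- The invariants of a tensor product of two representations on `V` have dimension at most one
if the second one is irreducible. -/
theorem finrank_invariants_le_one [FiniteDimensional k V] [IsAlgClosed k] [Nontrivial V]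
    (ρ σ : H →ₐ[k] Module.End k V)
    (hirr : ∀ U : Submodule k V, (∀ (h : H) (v : V), v ∈ U → σ h v ∈ U) → U = ⊥ ∨ U = ⊤)
    (I : Submodule k (V ⊗[k] V))
    (hI : ∀ t ∈ I, ∀ h : H, tensorAction ρ σ (Coalgebra.comul (R := k) h) t =
      Coalgebra.counit (R := k) h • t) :
    Module.finrank k I ≤ 1 := by
  rw [← LinearEquiv.finrank_map_eq (tensorEquivDualHom k V) I]
  refine finrank_le_one_of_forall_eq_zero_or_range_eq_top Subspace.dual_finrank_eq _ ?_
  rintro _ ⟨t, ht, rfl⟩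
  refine (hirr (LinearMap.range (tensorEquivDualHom k V t)) ?_).imp LinearMap.range_eq_bot.mp id
  rintro h _ ⟨φ, rfl⟩
  have key := congrArg (tensorEquivDualHom k V)
    (tensorAction_one_tmul_of_invariant ρ σ t (hI t ht) h)
  simp only [tensorAction_tmul, tensorEquivDualHom_map, map_one] at key
  exact ⟨(ρ (HopfAlgebra.antipode k h)).dualMap φ, (LinearMap.congr_fun key φ).symm⟩

end FrobeniusSchur

/-- **Theorem.** For an irreducible finite-dimensional module `(V, ρ)` over a finite-dimensional
semisimple Hopf algebra `H` over an algebraically closed field of characteristic `0`, and a Hopf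
algebra automorphism `τ` with `τ² = Id`, the second twisted Frobenius–Schur indicator
`ν₂(χ, τ) = Σ χ(Λ₁ τ(Λ₂))` equals `0`, `1` or `-1`. -/
theorem twisted_second_FS_indicator_eq_zero_or_one_or_neg_one
    (H V : Type u) [Ring H] [HopfAlgebra k H]
    [IsAlgClosed k] [CharZero k] [FiniteDimensional k H] [IsSemisimpleRing H]
    [AddCommGroup V] [Module k V] [FiniteDimensional k V]
    (Λ : H)
    (hΛleft : ∀ a : H, a * Λ = Coalgebra.counit (R := k) a • Λ)
    (hΛright : ∀ a : H, Λ * a = Coalgebra.counit (R := k) a • Λ)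
    (hΛone : Coalgebra.counit (R := k) Λ = 1)
    (hΛcc : TensorProduct.comm k H H (Coalgebra.comul (R := k) Λ) = Coalgebra.comul (R := k) Λ)
    (τ : H →ₗ[k] H)
    (hτmul : ∀ a b : H, τ (a * b) = τ a * τ b) (hτone : τ 1 = 1)
    (hτcomul : Coalgebra.comul (R := k) ∘ₗ τ =
      TensorProduct.map τ τ ∘ₗ Coalgebra.comul (R := k))
    (hτcounit : Coalgebra.counit (R := k) ∘ₗ τ = Coalgebra.counit (R := k))
    (hτsq : τ ∘ₗ τ = LinearMap.id)
    (ρ : H →ₐ[k] Module.End k V)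
    [Nontrivial V]
    (hirr : ∀ U : Submodule k V, (∀ (h : H) (v : V), v ∈ U → ρ h v ∈ U) → U = ⊥ ∨ U = ⊤)
    :
    LinearMap.trace k V (ρ (twistedMulMap k H τ 1 Λ)) = 0 ∨
      LinearMap.trace k V (ρ (twistedMulMap k H τ 1 Λ)) = 1 ∨
      LinearMap.trace k V (ρ (twistedMulMap k H τ 1 Λ)) = -1 := by
  let τ' : H →ₐ[k] H := AlgHom.ofLinearMap τ hτone hτmul
  have hττ (h : H) : τ (τ h) = h := LinearMap.congr_fun hτsq h
  have hετ (h : H) : Coalgebra.counit (R := k) (τ h) = Coalgebra.counit (R := k) h :=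
    LinearMap.congr_fun hτcounit h
  let σ : H →ₐ[k] Module.End k V := ρ.comp τ'
  have hσirr (U : Submodule k V) (hU : ∀ (h : H) (v : V), v ∈ U → σ h v ∈ U) :
      U = ⊥ ∨ U = ⊤ := by
    refine hirr U fun h v hv => ?_
    have := hU (τ h) v hv
    rwa [show σ (τ h) = ρ h from congrArg ρ (hττ h)] at this
  have hτΛ : τ Λ = Λ := by
    have h1 : Λ * τ Λ = Λ := by rw [hΛright, hετ, hΛone, one_smul]
    have h2 : Λ * τ Λ = τ Λ := by
      have h := congrArg τ (hΛleft (τ Λ))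
      rwa [hτmul, hττ, map_smul, hετ, hΛone, one_smul] at h
    rw [← h2, h1]
  have hΔ : TensorProduct.map τ τ (Coalgebra.comul (R := k) Λ) = Coalgebra.comul (R := k) Λ := by
    rw [← LinearMap.comp_apply, ← hτcomul, LinearMap.comp_apply, hτΛ]
  set P := tensorAction ρ σ (Coalgebra.comul (R := k) Λ) with hPdef
  have hcomulmul (a b : H) : Coalgebra.comul (R := k) (a * b) =
      Coalgebra.comul (R := k) a * Coalgebra.comul (R := k) b := Bialgebra.comul_mul a b
  have hinv (h : H) (x : V ⊗[k] V) : tensorAction ρ σ (Coalgebra.comul (R := k) h) (P x) =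
      Coalgebra.counit (R := k) h • P x := by
    rw [hPdef, ← Module.End.mul_apply, ← map_mul, ← hcomulmul, hΛleft, map_smul, map_smul,
      LinearMap.smul_apply]
  let s : Module.End k (V ⊗[k] V) := (TensorProduct.comm k V V).toLinearMap
  have hflip (y : H ⊗[k] H) : s ∘ₗ tensorAction ρ σ y = tensorAction ρ σ
      (TensorProduct.map τ τ (TensorProduct.comm k H H y)) ∘ₗ s := by
    induction y with
    | zero => simp
    | add x y hx hy => simp only [map_add, LinearMap.comp_add, LinearMap.add_comp, hx, hy]
    | tmul a b =>
      ext v w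
      simp [s, σ, τ', hττ]
  have hsP (x : V ⊗[k] V) : s (P x) = P (s x) := by
    have := LinearMap.congr_fun (hflip (Coalgebra.comul (R := k) Λ)) x
    rwa [hΛcc, hΔ] at this
  have htr : LinearMap.trace k V (ρ (twistedMulMap k H τ 1 Λ)) =
      LinearMap.trace k (V ⊗[k] V) (s ∘ₗ P) := by
    have (y : H ⊗[k] H) :
        LinearMap.trace k V (ρ (LinearMap.mul' k H (TensorProduct.map LinearMap.id τ y))) =
          LinearMap.trace k (V ⊗[k] V) (s ∘ₗ tensorAction ρ σ y) := by
      induction y with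
      | zero => simp
      | add x y hx hy => simp only [map_add, LinearMap.comp_add, hx, hy]
      | tmul a b =>
        rw [tensorAction_tmul, trace_comm_comp_map]
        simp [σ, τ', Module.End.mul_eq_comp]
    exact this _
  rw [htr]
  refine trace_involution_comp_idempotent s P (fun x => ?_) (fun x => ?_) hsP ?_
  · exact (TensorProduct.comm k V V).symm_apply_apply x
  · rw [hPdef, hinv, hΛone, one_smul]
  · refine finrank_invariants_le_one ρ σ hσirr _ ?_
    rintro _ ⟨x, rfl⟩ h
    exact hinv h x

end
end

section
/- Let τ be a Hopf algebra automorphism of H with τ^m = Id, and let χ_R be the character of the left regular representation of H. Then ν_m(χ_R, τ) = tr(Ω^τ_m), where Ω^τ_m: H → H is the linear map Ω^τ_m(h) = Σ_(h) S(τ^{m-1}(h₁) τ^{m-2}(h₂) ⋯ τ²(h_{m-2}) τ(h_{m-1})). -/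
open TensorProduct

noncomputable section

universe u

variable (k : Type u) [Field k]

/-- The map `h ↦ Σ τ^{r}(h₁) τ^{r-1}(h₂) ⋯ τ(h_r)` (`r` Sweedler factors). -/
def revTwist (H : Type u) [Ring H] [HopfAlgebra k H] (τ : H →ₗ[k] H) : ℕ → (H →ₗ[k] H)
  | 0 => Algebra.linearMap k H ∘ₗ Coalgebra.counit (R := k)
  | r + 1 => LinearMap.mul' k H ∘ₗ
      TensorProduct.map (powLM k H τ (r + 1)) (revTwist H τ r) ∘ₗ Coalgebra.comul (R := k)

section HopfAlgebraLemmas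

open Coalgebra HopfAlgebra WithConv Algebra.TensorProduct

variable {k} {H : Type u} [Ring H] [HopfAlgebra k H]

/-- The comultiplication is the convolution product of the two inclusions `H → H ⊗ H`. -/
lemma toConv_comul_eq_mul :
    toConv (comul (R := k) (A := H)) =
      toConv (includeLeft (R := k) (S := k) (A := H) (B := H)).toLinearMap *
        toConv (includeRight (R := k) (A := H) (B := H)).toLinearMap := by
  ext h
  rw [(ℛ k h).convMul_apply]
  simp [← (ℛ k h).eq]

lemma algHom_comp_antipode_convMul {A : Type*} [Ring A] [Algebra k A] (f : H →ₐ[k] A) :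
    toConv (f.toLinearMap ∘ₗ antipode k) * toConv f.toLinearMap = 1 := by
  have h := LinearMap.algHom_comp_convMul_distrib f (toConv (antipode k (A := H)))
    (toConv LinearMap.id)
  rw [LinearMap.antipode_mul_id] at h
  ext x
  simpa using (LinearMap.congr_fun h x).symm

lemma algHom_convMul_comp_antipode {A : Type*} [Ring A] [Algebra k A] (f : H →ₐ[k] A) :
    toConv f.toLinearMap * toConv (f.toLinearMap ∘ₗ antipode k) = 1 := by
  have h := LinearMap.algHom_comp_convMul_distrib f (toConv LinearMap.id)
    (toConv (antipode k (A := H)))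
  rw [LinearMap.id_mul_antipode] at h
  ext x
  simpa using (LinearMap.congr_fun h x).symm

/-- The antipode is an anti-homomorphism of coalgebras. -/
lemma comul_antipode (h : H) :
    comul (R := k) (antipode k h) =
      TensorProduct.map (antipode k) (antipode k) (TensorProduct.comm k H H (comul h)) := by
  have hleft : (toConv ((includeRight (R := k) (A := H) (B := H)).toLinearMap ∘ₗ antipode k) *
      toConv ((includeLeft (R := k) (S := k) (A := H) (B := H)).toLinearMap ∘ₗ antipode k)) *
      toConv (comul (R := k) (A := H)) = 1 := by
    have hcancel {r l a b : WithConv (H →ₗ[k] H ⊗[k] H)} (hla : l * a = 1) (hrb : r * b = 1) :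
        r * l * (a * b) = 1 := by
      rw [mul_assoc, ← mul_assoc l, hla, one_mul, hrb]
    rw [toConv_comul_eq_mul]
    exact hcancel (algHom_comp_antipode_convMul _) (algHom_comp_antipode_convMul _)
  have heq := left_inv_eq_right_inv hleft LinearMap.comul_right_inv
  have happ := LinearMap.congr_fun (congrArg ofConv heq) h
  refine happ.symm.trans ?_
  change (_ * _ : WithConv (H →ₗ[k] H ⊗[k] H)) h = _
  rw [(ℛ k h).convMul_apply, ← (ℛ k h).eq]
  simp

/-- A bialgebra endomorphism commutes with the antipode. -/
lemma map_antipode_of_bialgHom (τ : H →ₐc[k] H) (h : H) :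
    τ (antipode k h) = antipode k (τ h) := by
  have hright := algHom_convMul_comp_antipode (τ : H →ₐ[k] H)
  have hleft : toConv (antipode k ∘ₗ (τ : H →ₐ[k] H).toLinearMap) *
      toConv (τ : H →ₐ[k] H).toLinearMap = 1 := by
    have h := LinearMap.convMul_comp_coalgHom_distrib (toConv (antipode k (A := H)))
      (toConv LinearMap.id) τ.toCoalgHom
    rw [LinearMap.antipode_mul_id] at h
    ext x
    have hx := (LinearMap.congr_fun h x).symm
    refine Eq.trans hx ?_
    simp
  exact (LinearMap.congr_fun (congrArg ofConv (left_inv_eq_right_inv hleft hright)) h).symm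

/-- Left multiplication on the comultiplication of a left integral can be moved across the
tensor sign at the cost of an antipode. -/
lemma one_tmul_mul_comul_of_leftIntegral {Λ : H}
    (hΛ : ∀ a : H, a * Λ = counit (R := k) a • Λ) (a : H) :
    (1 ⊗ₜ[k] a) * comul (R := k) Λ = (antipode k a ⊗ₜ[k] 1) * comul (R := k) Λ := by
  have hconv : toConv ((includeLeft (R := k) (S := k) (A := H) (B := H)).toLinearMap ∘ₗ
      antipode k) * toConv (comul (R := k) (A := H)) =
      toConv (includeRight (R := k) (A := H) (B := H)).toLinearMap := by
    rw [toConv_comul_eq_mul, ← mul_assoc, algHom_comp_antipode_convMul, one_mul]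
  have happ := LinearMap.congr_fun (congrArg ofConv hconv) a
  change (_ * _ : WithConv (H →ₗ[k] H ⊗[k] H)) a = 1 ⊗ₜ[k] a at happ
  rw [(ℛ k a).convMul_apply] at happ
  rw [← happ, Finset.sum_mul]
  have hcomul (b : H) : comul (R := k) b * comul (R := k) Λ =
      counit (R := k) b • comul (R := k) Λ := by
    rw [← Bialgebra.comul_mul, hΛ, map_smul]
  change ∑ i ∈ (ℛ k a).index, (antipode k ((ℛ k a).left i) ⊗ₜ[k] 1) *
    comul ((ℛ k a).right i) * comul Λ = _
  simp only [mul_assoc, hcomul, mul_smul_comm]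
  have ha := congrArg (TensorProduct.rid k H) (sum_tmul_counit_eq (ℛ k a))
  simp only [map_sum, TensorProduct.rid_tmul, one_smul] at ha
  conv_rhs => rw [← ha]
  simp [TensorProduct.sum_tmul, Finset.sum_mul, ← TensorProduct.smul_tmul']

/-- Contraction of the second tensor factor with a linear functional. -/
def sliceRight (f : H →ₗ[k] k) : H ⊗[k] H →ₗ[k] H :=
  (TensorProduct.rid k H).toLinearMap ∘ₗ f.lTensor H

@[simp]
lemma sliceRight_tmul (f : H →ₗ[k] k) (a b : H) :
    sliceRight f (a ⊗ₜ[k] b) = f b • a := by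
  simp [sliceRight]

lemma sliceRight_tmul_one_mul (f : H →ₗ[k] k) (a : H) (t : H ⊗[k] H) :
    sliceRight f ((a ⊗ₜ[k] 1) * t) = a * sliceRight f t := by
  induction t with
  | zero => simp
  | tmul x y => simp
  | add x y hx hy => simp [mul_add, hx, hy]

lemma sliceRight_one_tmul_mul (f : H →ₗ[k] k) (a : H) {x : H} {ι : Type*} (r : Repr k x ι) :
    sliceRight f ((1 ⊗ₜ[k] a) * comul (R := k) x) =
      ∑ i ∈ r.index, f (a * r.right i) • r.left i := by
  rw [← r.eq]
  simp [Finset.mul_sum]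

lemma trace_eq_sum_of_forall_eq_sum_smul [FiniteDimensional k H] {ι : Type*} (s : Finset ι)
    (φ : H →ₗ[k] H →ₗ[k] k) (u v : ι → H) (L : H →ₗ[k] H)
    (hL : ∀ x, L x = ∑ i ∈ s, φ x (v i) • u i) :
    LinearMap.trace k H L = ∑ i ∈ s, φ (u i) (v i) := by
  have hL' : L = ∑ i ∈ s, (φ.flip (v i)).smulRight (u i) := by
    ext x
    simp [hL]
  simp [hL', LinearMap.trace_smulRight]

/-- A two-sided normalized integral is fixed by an involutive antipode. -/
lemma antipode_integral {Λ : H} (hΛright : ∀ a : H, Λ * a = counit (R := k) a • Λ)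
    (hΛone : counit (R := k) Λ = 1) (hS : ∀ a : H, antipode k (antipode k a) = a) :
    antipode k Λ = Λ := by
  have hmul : Λ * antipode k Λ = Λ := by rw [hΛright, counit_antipode, hΛone, one_smul]
  have := congrArg (antipode k) hmul
  rwa [antipode_mul_antidistrib, hS, hmul, eq_comm] at this

variable [FiniteDimensional k H] {Λ : H}

/-- The comultiplication of a normalized left integral is a nondegenerate tensor. -/
lemma exists_sliceRight_comul_eq_one
    (hΛleft : ∀ a : H, a * Λ = counit (R := k) a • Λ) (hΛone : counit (R := k) Λ = 1) :
    ∃ f : H →ₗ[k] k, sliceRight f (comul (R := k) Λ) = 1 := by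
  let C : (H →ₗ[k] k) →ₗ[k] H :=
    { toFun := fun f => sliceRight f (comul (R := k) Λ)
      map_add' := fun f g => by simp [sliceRight, LinearMap.lTensor_add]
      map_smul' := fun c f => by simp [sliceRight, LinearMap.lTensor_smul] }
  have hinj : Function.Injective C := by
    rw [← LinearMap.ker_eq_bot, LinearMap.ker_eq_bot']
    intro f hf
    ext b
    have hzero := trace_eq_sum_of_forall_eq_sum_smul (ℛ k Λ).index
      (TensorProduct.curry ((f ∘ₗ LinearMap.mulLeft k b) ∘ₗ LinearMap.mul' k H) ∘ₗ antipode k)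
      (ℛ k Λ).left (ℛ k Λ).right 0 (fun x => by
          have := sliceRight_one_tmul_mul f (b * antipode k x) (ℛ k Λ)
          rw [one_tmul_mul_comul_of_leftIntegral hΛleft, sliceRight_tmul_one_mul] at this
          rw [show sliceRight f (comul (R := k) Λ) = 0 from hf, mul_zero] at this
          simpa [mul_assoc] using this)
    have hb : ∑ i ∈ (ℛ k Λ).index,
        f (b * (antipode k ((ℛ k Λ).left i) * (ℛ k Λ).right i)) = f b := by
      rw [← map_sum, ← Finset.mul_sum, sum_antipode_mul_eq_smul, hΛone, one_smul, mul_one]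
    rw [← hb]
    simpa using hzero.symm
  have hsurj : Function.Surjective C :=
    (LinearMap.injective_iff_surjective_of_finrank_eq_finrank
      (Subspace.dual_finrank_eq (K := k) (V := H))).mp hinj
  exact hsurj 1

/-- The antipode is an involution if the normalized left integral is cocommutative. -/
lemma antipode_antipode_of_cocommutative_integral
    (hΛleft : ∀ a : H, a * Λ = counit (R := k) a • Λ) (hΛone : counit (R := k) Λ = 1)
    (hΛcc : TensorProduct.comm k H H (comul (R := k) Λ) = comul (R := k) Λ) (a : H) :
    antipode k (antipode k a) = a := by
  obtain ⟨f, hf⟩ := exists_sliceRight_comul_eq_one hΛleft hΛone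
  have hcomm (x y : H ⊗[k] H) : TensorProduct.comm k H H (x * y) =
      TensorProduct.comm k H H x * TensorProduct.comm k H H y :=
    map_mul (Algebra.TensorProduct.comm k H H) x y
  have hswap := congrArg (TensorProduct.comm k H H)
    (one_tmul_mul_comul_of_leftIntegral hΛleft a)
  rw [hcomm, hcomm, hΛcc, TensorProduct.comm_tmul, TensorProduct.comm_tmul,
    one_tmul_mul_comul_of_leftIntegral hΛleft] at hswap
  have := congrArg (sliceRight f) hswap
  simpa [sliceRight_tmul_one_mul, hf] using this.symm

lemma trace_eq_sum_of_sliceRight_comul_eq_one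
    (hΛleft : ∀ a : H, a * Λ = counit (R := k) a • Λ)
    (hS : ∀ a : H, antipode k (antipode k a) = a) {f : H →ₗ[k] k}
    (hf : sliceRight f (comul (R := k) Λ) = 1) (T : H →ₗ[k] H) {ι : Type*} (r : Repr k Λ ι) :
    LinearMap.trace k H T =
      ∑ i ∈ r.index, f (antipode k (T (r.left i)) * r.right i) := by
  have hx (x : H) : x = ∑ i ∈ r.index, f (antipode k x * r.right i) • r.left i := by
    rw [← sliceRight_one_tmul_mul, one_tmul_mul_comul_of_leftIntegral hΛleft,
      sliceRight_tmul_one_mul, hf, hS, mul_one]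
  simpa using trace_eq_sum_of_forall_eq_sum_smul r.index
    (TensorProduct.curry (f ∘ₗ LinearMap.mul' k H) ∘ₗ antipode k ∘ₗ T) r.left r.right T
    (fun x => by simpa using hx (T x))

lemma trace_lmul_eq (hΛleft : ∀ a : H, a * Λ = counit (R := k) a • Λ)
    (hΛone : counit (R := k) Λ = 1)
    (hS : ∀ a : H, antipode k (antipode k a) = a) {f : H →ₗ[k] k}
    (hf : sliceRight f (comul (R := k) Λ) = 1) (a : H) :
    LinearMap.trace k H (Algebra.lmul k H a) = f a := by
  let e : H ≃ₗ[k] H := LinearEquiv.ofLinearMap (antipode k) (antipode k)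
    (LinearMap.ext hS) (LinearMap.ext hS)
  have hconj : e.conj (LinearMap.mulRight k (antipode k a)) = Algebra.lmul k H a := by
    ext x
    change antipode k (antipode k x * antipode k a) = a * x
    rw [antipode_mul_antidistrib, hS, hS]
  rw [← hconj, LinearMap.trace_conj', trace_eq_sum_of_sliceRight_comul_eq_one hΛleft hS hf _
    (ℛ k Λ)]
  simp only [LinearMap.mulRight_apply, antipode_mul_antidistrib, hS, mul_assoc]
  rw [← map_sum, ← Finset.mul_sum, sum_antipode_mul_eq_smul, hΛone, one_smul, mul_one]

/-- The regular character is invariant under the antipode. -/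
lemma trace_lmul_antipode (hΛleft : ∀ a : H, a * Λ = counit (R := k) a • Λ)
    (hΛone : counit (R := k) Λ = 1)
    (hΛcc : TensorProduct.comm k H H (comul (R := k) Λ) = comul (R := k) Λ)
    (a : H) :
    LinearMap.trace k H (Algebra.lmul k H (antipode k a)) =
      LinearMap.trace k H (Algebra.lmul k H a) := by
  have hS := antipode_antipode_of_cocommutative_integral hΛleft hΛone hΛcc
  obtain ⟨f, hf⟩ := exists_sliceRight_comul_eq_one hΛleft hΛone
  have hχ := trace_lmul_eq hΛleft hΛone hS hf
  have hf_comm (x y : H) : f (x * y) = f (y * x) := by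
    rw [← hχ, ← hχ, map_mul (Algebra.lmul k H), map_mul (Algebra.lmul k H),
      LinearMap.trace_mul_comm]
  have hflip : ∑ i ∈ (ℛ k Λ).index, (ℛ k Λ).right i * antipode k ((ℛ k Λ).left i) = 1 := by
    have h := congrArg (LinearMap.mul' k H ∘ₗ (antipode k).lTensor H) hΛcc
    rw [LinearMap.comp_apply, LinearMap.comp_apply, mul_antipode_lTensor_comul_apply, hΛone,
      map_one, ← (ℛ k Λ).eq] at h
    simpa using h
  rw [trace_eq_sum_of_sliceRight_comul_eq_one hΛleft hS hf (Algebra.lmul k H a) (ℛ k Λ), hχ]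
  have hterm (x y : H) : f (antipode k (a * x) * y) = f (antipode k a * (y * antipode k x)) := by
    rw [antipode_mul_antidistrib, mul_assoc, hf_comm, mul_assoc]
  change _ = ∑ i ∈ (ℛ k Λ).index,
    f (antipode k (a * (ℛ k Λ).left i) * (ℛ k Λ).right i)
  simp only [hterm]
  rw [← map_sum, ← Finset.mul_sum, hflip, mul_one]

end HopfAlgebraLemmas

section TwistedProducts

open Coalgebra HopfAlgebra WithConv

variable {k} {H : Type u} [Ring H] [HopfAlgebra k H]

lemma toConv_revTwist_succ_mul_id (τ : H →ₗ[k] H) (n : ℕ) :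
    toConv (revTwist k H τ (n + 1)) * toConv LinearMap.id =
      toConv (powLM k H τ (n + 1)) * (toConv (revTwist k H τ n) * toConv LinearMap.id) := by
  rw [← mul_assoc]
  rfl

/-- The leading factor of the reversed twisted product can be traded for a trailing one. -/
lemma toConv_comp_revTwist_mul_id (τ : H →ₐ[k] H) (n : ℕ) :
    toConv (τ.toLinearMap ∘ₗ
        (toConv (revTwist k H τ.toLinearMap n) * toConv LinearMap.id).ofConv) *
      toConv LinearMap.id =
      toConv (revTwist k H τ.toLinearMap (n + 1)) * toConv LinearMap.id := by
  induction n with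
  | zero =>
    have h0 : toConv (revTwist k H τ.toLinearMap 0) = 1 := rfl
    rw [toConv_revTwist_succ_mul_id, h0, one_mul]
    rfl
  | succ n ih =>
    rw [toConv_revTwist_succ_mul_id _ n, LinearMap.algHom_comp_convMul_distrib, toConv_ofConv,
      mul_assoc, ih, toConv_revTwist_succ_mul_id _ (n + 1)]
    rfl

/-- The antipode turns the reversed twisted product into the twisted product. -/
lemma antipode_revTwist_mul_id (τ : H →ₐc[k] H) (n : ℕ) (h : H) :
    antipode k ((toConv (revTwist k H (τ : H →ₐ[k] H).toLinearMap n) *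
        toConv LinearMap.id : WithConv (H →ₗ[k] H)) h) =
      twistedMulMap k H (τ : H →ₐ[k] H).toLinearMap n (antipode k h) := by
  induction n generalizing h with
  | zero =>
    have h0 : toConv (revTwist k H (τ : H →ₐ[k] H).toLinearMap 0) = 1 := rfl
    rw [h0, one_mul]
    rfl
  | succ n ih =>
    rw [← toConv_comp_revTwist_mul_id, (ℛ k h).convMul_apply, map_sum]
    change _ = LinearMap.mul' k H (TensorProduct.map LinearMap.id
      ((τ : H →ₐ[k] H).toLinearMap ∘ₗ twistedMulMap k H (τ : H →ₐ[k] H).toLinearMap n)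
      (comul (antipode k h)))
    rw [comul_antipode, ← (ℛ k h).eq]
    simp only [map_sum, TensorProduct.comm_tmul, TensorProduct.map_tmul, LinearMap.mul'_apply,
      LinearMap.comp_apply, ← ih, antipode_mul_antidistrib]
    refine Finset.sum_congr rfl fun i _ => ?_
    exact congrArg _ (map_antipode_of_bialgHom τ _).symm

end TwistedProducts

/-- **Theorem.** Let `H` be a finite-dimensional semisimple Hopf algebra over an algebraically
closed field of characteristic `0` with normalized two-sided integral `Λ`, and `τ` a Hopf
algebra automorphism with `τ^m = Id` (`m ≥ 1`).  The `m`-th twisted Frobenius–Schur indicator of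
the character `χ_R` of the left regular representation satisfies `ν_m(χ_R, τ) = tr(Ω^τ_m)`,
where `Ω^τ_m : H → H` is the linear map
`Ω^τ_m(h) = Σ S(τ^{m-1}(h₁) τ^{m-2}(h₂) ⋯ τ²(h_{m-2}) τ(h_{m-1}))`. -/
theorem twisted_FS_indicator_of_regular_representation_eq_trace_Omega
    (H : Type u) [Ring H] [HopfAlgebra k H]
    [IsAlgClosed k] [CharZero k] [FiniteDimensional k H] [IsSemisimpleRing H]
    (Λ : H)
    (hΛleft : ∀ a : H, a * Λ = Coalgebra.counit (R := k) a • Λ)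
    (hΛright : ∀ a : H, Λ * a = Coalgebra.counit (R := k) a • Λ)
    (hΛone : Coalgebra.counit (R := k) Λ = 1)
    (hΛcc : TensorProduct.comm k H H (Coalgebra.comul (R := k) Λ) = Coalgebra.comul (R := k) Λ)
    (m : ℕ) (hm : 0 < m)
    (τ : H →ₗ[k] H)
    (hτmul : ∀ a b : H, τ (a * b) = τ a * τ b) (hτone : τ 1 = 1)
    (hτcomul : Coalgebra.comul (R := k) ∘ₗ τ =
      TensorProduct.map τ τ ∘ₗ Coalgebra.comul (R := k))
    (hτcounit : Coalgebra.counit (R := k) ∘ₗ τ = Coalgebra.counit (R := k))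
    (hτord : powLM k H τ m = LinearMap.id) :
    LinearMap.trace k H (Algebra.lmul k H (twistedMulMap k H τ (m - 1) Λ)) =
      LinearMap.trace k H
        (HopfAlgebra.antipode (R := k) ∘ₗ revTwist k H τ (m - 1)) := by
  obtain ⟨τ, rfl⟩ : ∃ σ : H →ₐc[k] H, (σ : H →ₐ[k] H).toLinearMap = τ :=
    ⟨BialgHom.ofAlgHom (AlgHom.ofLinearMap τ hτone hτmul)
      (AlgHom.ext fun x => LinearMap.congr_fun hτcounit x)
      (AlgHom.ext fun x => (LinearMap.congr_fun hτcomul x).symm), rfl⟩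
  have hS := antipode_antipode_of_cocommutative_integral hΛleft hΛone hΛcc
  obtain ⟨f, hf⟩ := exists_sliceRight_comul_eq_one hΛleft hΛone
  have hW := antipode_revTwist_mul_id τ (m - 1) Λ
  rw [antipode_integral hΛright hΛone hS] at hW
  rw [← hW, trace_lmul_antipode hΛleft hΛone hΛcc, trace_lmul_eq hΛleft hΛone hS hf,
    trace_eq_sum_of_sliceRight_comul_eq_one hΛleft hS hf _ (Coalgebra.Repr.arbitrary k Λ),
    (Coalgebra.Repr.arbitrary k Λ).convMul_apply, map_sum]
  simp [hS]

end
end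

section
/- Let G be a finite group, τ an automorphism of G with τ² = Id, and (V,ρ) an irreducible complex representation of G with character χ. Then the twisted second Frobenius–Schur indicator (1/|G|) Σ_{g ∈ G} χ(g τ(g)) equals 0, 1, or −1; moreover it is nonzero if and only if V is isomorphic as a G-representation to its twisted dual V†, the dual space V* with action (g·f)(v) = f(ρ(τ(g⁻¹))v). -/
section TwistedInvariantForms

variable {G V : Type*} [Group G] [AddCommGroup V] [Module ℂ V]

/-- A bilinear form `B` is twisted invariant if `B (g v) (τ(g) w) = B v w` for all `g`. -/
def IsTwistedInvariant (ρ : Representation ℂ G V) (τ : MulAut G)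
    (B : V →ₗ[ℂ] V →ₗ[ℂ] ℂ) : Prop :=
  ∀ (g : G) (v w : V), B (ρ g v) (ρ (τ g) w) = B v w

/-- Averaging of bilinear forms over the twisted diagonal action of a finite group. -/
noncomputable def twistedAverage [Fintype G] (ρ : Representation ℂ G V) (τ : MulAut G) :
    (V →ₗ[ℂ] V →ₗ[ℂ] ℂ) →ₗ[ℂ] (V →ₗ[ℂ] V →ₗ[ℂ] ℂ) where
  toFun B := (Fintype.card G : ℂ)⁻¹ • ∑ g : G, B.compl₁₂ (ρ g) (ρ (τ g))
  map_add' B C := by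
    ext v w
    simp [Finset.sum_add_distrib, mul_add]
  map_smul' a B := by
    ext v w
    simp only [LinearMap.smul_apply, LinearMap.sum_apply, LinearMap.compl₁₂_apply, smul_eq_mul,
      RingHom.id_apply, ← Finset.mul_sum]
    ring

theorem twistedAverage_apply [Fintype G] (ρ : Representation ℂ G V) (τ : MulAut G)
    (B : V →ₗ[ℂ] V →ₗ[ℂ] ℂ) (v w : V) :
    twistedAverage ρ τ B v w =
      (Fintype.card G : ℂ)⁻¹ * ∑ g : G, B (ρ g v) (ρ (τ g) w) := by
  simp [twistedAverage]

theorem isTwistedInvariant_twistedAverage [Fintype G] (ρ : Representation ℂ G V) (τ : MulAut G)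
    (B : V →ₗ[ℂ] V →ₗ[ℂ] ℂ) : IsTwistedInvariant ρ τ (twistedAverage ρ τ B) := by
  intro h v w
  rw [twistedAverage_apply, twistedAverage_apply]
  congr 1
  rw [← Equiv.sum_comp (Equiv.mulRight h) fun g => B (ρ g v) (ρ (τ g) w)]
  simp

theorem IsTwistedInvariant.twistedAverage_eq [Fintype G] {ρ : Representation ℂ G V}
    {τ : MulAut G} {B : V →ₗ[ℂ] V →ₗ[ℂ] ℂ} (hB : IsTwistedInvariant ρ τ B) :
    twistedAverage ρ τ B = B := by
  ext v w
  have hcard : (Fintype.card G : ℂ) ≠ 0 := Nat.cast_ne_zero.mpr Fintype.card_ne_zero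
  rw [twistedAverage_apply, Finset.sum_congr rfl fun g _ => hB g v w]
  simp [hcard]

theorem IsTwistedInvariant.flip {ρ : Representation ℂ G V} {τ : MulAut G} (hτ : τ ^ 2 = 1)
    {B : V →ₗ[ℂ] V →ₗ[ℂ] ℂ} (hB : IsTwistedInvariant ρ τ B) :
    IsTwistedInvariant ρ τ B.flip := by
  intro g v w
  have hg : τ (τ g) = g := by
    have := DFunLike.congr_fun hτ g
    rwa [pow_two, MulAut.mul_apply, MulAut.one_apply] at this
  have := hB (τ g) w v
  rwa [hg] at this

theorem isTwistedInvariant_iff_equivariant (ρ : Representation ℂ G V) (τ : MulAut G)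
    (B : V →ₗ[ℂ] Module.Dual ℂ V) :
    IsTwistedInvariant ρ τ B ↔ ∀ (g : G) (v : V), B (ρ g v) = (ρ (τ g⁻¹)).dualMap (B v) := by
  constructor
  · intro hB g v
    ext w
    simpa [-map_inv, ← Module.End.mul_apply, ← map_mul] using hB g v (ρ (τ g⁻¹) w)
  · intro hB g v w
    rw [hB, LinearMap.dualMap_apply, ← Module.End.mul_apply, ← map_mul, ← map_mul]
    simp

/-- Schur's lemma: an endomorphism commuting with an irreducible complex representation is a
scalar. -/
theorem exists_eq_smul_id_of_commute [FiniteDimensional ℂ V] [Nontrivial V]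
    (ρ : Representation ℂ G V)
    (hirr : ∀ U : Submodule ℂ V, (∀ (g : G) (v : V), v ∈ U → ρ g v ∈ U) → U = ⊥ ∨ U = ⊤)
    (T : V →ₗ[ℂ] V) (hT : ∀ (g : G) (v : V), T (ρ g v) = ρ g (T v)) :
    ∃ c : ℂ, ∀ v, T v = c • v := by
  obtain ⟨c, hc⟩ := Module.End.exists_eigenvalue T
  refine ⟨c, fun v => ?_⟩
  have htop : Module.End.eigenspace T c = ⊤ := by
    refine (hirr _ fun g v hv => ?_).resolve_left hc
    rw [Module.End.mem_eigenspace_iff] at hv ⊢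
    rw [hT, hv, map_smul]
  exact Module.End.mem_eigenspace_iff.mp (htop ▸ Submodule.mem_top)

theorem IsTwistedInvariant.bijective_of_ne_zero [FiniteDimensional ℂ V]
    {ρ : Representation ℂ G V} {τ : MulAut G}
    (hirr : ∀ U : Submodule ℂ V, (∀ (g : G) (v : V), v ∈ U → ρ g v ∈ U) → U = ⊥ ∨ U = ⊤)
    {B : V →ₗ[ℂ] Module.Dual ℂ V} (hB : IsTwistedInvariant ρ τ B) (h0 : B ≠ 0) :
    Function.Bijective B := by
  have hker : LinearMap.ker B = ⊥ := by
    refine (hirr _ fun g v hv => ?_).resolve_right fun h => h0 (LinearMap.ker_eq_top.mp h)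
    rw [LinearMap.mem_ker] at hv ⊢
    rw [(isTwistedInvariant_iff_equivariant ρ τ B).mp hB, hv, map_zero]
  have hinj := LinearMap.ker_eq_bot.mp hker
  exact ⟨hinj, (LinearMap.injective_iff_surjective_of_finrank_eq_finrank
    Subspace.dual_finrank_eq.symm).mp hinj⟩

theorem IsTwistedInvariant.exists_eq_smul [FiniteDimensional ℂ V] [Nontrivial V]
    {ρ : Representation ℂ G V} {τ : MulAut G}
    (hirr : ∀ U : Submodule ℂ V, (∀ (g : G) (v : V), v ∈ U → ρ g v ∈ U) → U = ⊥ ∨ U = ⊤)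
    {e : V ≃ₗ[ℂ] Module.Dual ℂ V} (he : IsTwistedInvariant ρ τ e.toLinearMap)
    {B : V →ₗ[ℂ] V →ₗ[ℂ] ℂ} (hB : IsTwistedInvariant ρ τ B) :
    ∃ c : ℂ, B = c • e.toLinearMap := by
  rw [isTwistedInvariant_iff_equivariant] at he hB
  obtain ⟨c, hc⟩ := exists_eq_smul_id_of_commute ρ hirr (e.symm.toLinearMap ∘ₗ B) fun g v => by
    apply e.injective
    have := he g (e.symm (B v))
    simp only [LinearEquiv.coe_coe, LinearEquiv.apply_symm_apply] at this
    simp only [LinearMap.comp_apply, LinearEquiv.coe_coe, LinearEquiv.apply_symm_apply]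
    rw [hB, this]
  refine ⟨c, LinearMap.ext fun v => ?_⟩
  have := congrArg e (hc v)
  simpa using this

/-- The twisted indicator is the trace of averaging followed by flipping, expanded in a basis. -/
theorem twisted_indicator_eq_sum [Fintype G] {ι : Type*} [Fintype ι] [DecidableEq ι]
    (b : Module.Basis ι ℂ V) (ρ : Representation ℂ G V) (τ : MulAut G) :
    (Fintype.card G : ℂ)⁻¹ * ∑ g : G, LinearMap.trace ℂ V (ρ (g * τ g)) =
      ∑ i, ∑ j, twistedAverage ρ τ ((b.coord i).smulRight (b.coord j)) (b j) (b i) := by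
  simp only [twistedAverage_apply, ← Finset.mul_sum]
  congr 1
  rw [Finset.sum_congr rfl fun i _ => Finset.sum_comm, Finset.sum_comm]
  refine Finset.sum_congr rfl fun g _ => ?_
  rw [LinearMap.trace_eq_matrix_trace ℂ b, map_mul, LinearMap.toMatrix_mul]
  simp [Matrix.trace, Matrix.mul_apply, LinearMap.toMatrix_apply]

theorem sum_smul_coord_smulRight_coord {ι : Type*} [Fintype ι]
    (b : Module.Basis ι ℂ V) (B : V →ₗ[ℂ] V →ₗ[ℂ] ℂ) :
    ∑ i, ∑ j, B (b i) (b j) • (b.coord i).smulRight (b.coord j) = B := by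
  classical
  refine b.ext fun k => b.ext fun l => ?_
  simp [LinearMap.sum_apply, Finsupp.single_apply]

theorem twisted_indicator_eq_of_flip_eq_smul [Fintype G] [FiniteDimensional ℂ V] [Nontrivial V]
    {ρ : Representation ℂ G V} {τ : MulAut G}
    (hirr : ∀ U : Submodule ℂ V, (∀ (g : G) (v : V), v ∈ U → ρ g v ∈ U) → U = ⊥ ∨ U = ⊤)
    {e : V ≃ₗ[ℂ] Module.Dual ℂ V} (he : IsTwistedInvariant ρ τ e.toLinearMap) {ε : ℂ}
    (hε : ∀ v w, e w v = ε * e v w) :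
    (Fintype.card G : ℂ)⁻¹ * ∑ g : G, LinearMap.trace ℂ V (ρ (g * τ g)) = ε := by
  let b := Module.finBasis ℂ V
  have hscalar := fun i j => IsTwistedInvariant.exists_eq_smul hirr he
    (isTwistedInvariant_twistedAverage ρ τ ((b.coord i).smulRight (b.coord j)))
  choose c hc using hscalar
  have hsum : (∑ i, ∑ j, e (b i) (b j) * c i j) = 1 := by
    have h := he.twistedAverage_eq
    rw [← sum_smul_coord_smulRight_coord b e.toLinearMap] at h
    simp only [map_sum, map_smul, hc, smul_smul, ← Finset.sum_smul] at h
    rw [sum_smul_coord_smulRight_coord b e.toLinearMap] at h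
    obtain ⟨v, hv⟩ := exists_ne (0 : V)
    have hev : e v ≠ 0 := e.map_ne_zero_iff.mpr hv
    have h' := LinearMap.congr_fun h v
    exact smul_left_injective ℂ hev (by simpa using h')
  rw [twisted_indicator_eq_sum b]
  calc _ = ε * ∑ i, ∑ j, e (b i) (b j) * c i j := by
        simp only [Finset.mul_sum]
        refine Finset.sum_congr rfl fun i _ => Finset.sum_congr rfl fun j _ => ?_
        rw [hc]
        simp only [LinearMap.smul_apply, LinearEquiv.coe_coe, smul_eq_mul]
        rw [hε (b i) (b j)]
        ring
    _ = ε := by rw [hsum, mul_one]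

theorem twisted_indicator_eq_one_or_neg_one [Fintype G] [FiniteDimensional ℂ V] [Nontrivial V]
    {ρ : Representation ℂ G V} {τ : MulAut G} (hτ : τ ^ 2 = 1)
    (hirr : ∀ U : Submodule ℂ V, (∀ (g : G) (v : V), v ∈ U → ρ g v ∈ U) → U = ⊥ ∨ U = ⊤)
    {e : V ≃ₗ[ℂ] Module.Dual ℂ V} (he : IsTwistedInvariant ρ τ e.toLinearMap) :
    (Fintype.card G : ℂ)⁻¹ * ∑ g : G, LinearMap.trace ℂ V (ρ (g * τ g)) = 1 ∨
      (Fintype.card G : ℂ)⁻¹ * ∑ g : G, LinearMap.trace ℂ V (ρ (g * τ g)) = -1 := by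
  obtain ⟨ε, hflip⟩ := IsTwistedInvariant.exists_eq_smul hirr he (he.flip hτ)
  have hε : ∀ v w, e w v = ε * e v w := fun v w => by
    simpa using LinearMap.congr_fun₂ hflip v w
  obtain ⟨v, hv⟩ := exists_ne (0 : V)
  obtain ⟨w, hw⟩ : ∃ w, e v w ≠ 0 := by
    by_contra! h
    exact e.map_ne_zero_iff.mpr hv (LinearMap.ext h)
  have hsq : ε * ε = 1 := by
    refine mul_right_cancel₀ hw ?_
    rw [mul_assoc, ← hε v w, ← hε w v, one_mul]
  rw [twisted_indicator_eq_of_flip_eq_smul hirr he hε]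
  exact mul_self_eq_one_iff.mp hsq

theorem exists_equiv_of_twisted_indicator_ne_zero [Fintype G] [FiniteDimensional ℂ V]
    {ρ : Representation ℂ G V} {τ : MulAut G}
    (hirr : ∀ U : Submodule ℂ V, (∀ (g : G) (v : V), v ∈ U → ρ g v ∈ U) → U = ⊥ ∨ U = ⊤)
    (h : (Fintype.card G : ℂ)⁻¹ * ∑ g : G, LinearMap.trace ℂ V (ρ (g * τ g)) ≠ 0) :
    ∃ e : V ≃ₗ[ℂ] Module.Dual ℂ V, IsTwistedInvariant ρ τ e.toLinearMap := by
  by_contra! hno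
  have hzero (B : V →ₗ[ℂ] V →ₗ[ℂ] ℂ) : twistedAverage ρ τ B = 0 := by
    by_contra h0
    have hinv := isTwistedInvariant_twistedAverage ρ τ B
    exact hno (LinearEquiv.ofBijective _ (hinv.bijective_of_ne_zero hirr h0)) hinv
  refine h ?_
  rw [twisted_indicator_eq_sum (Module.finBasis ℂ V)]
  simp [hzero]

end TwistedInvariantForms


/-- **Theorem.** Let `G` be a finite group, `τ` an automorphism of `G` with `τ² = Id`, and
`(V, ρ)` an irreducible finite-dimensional complex representation of `G` with character
`χ = tr ∘ ρ`.  Then the twisted second Frobenius–Schur indicator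
`(1/|G|) Σ_{g ∈ G} χ(g τ(g))` equals `0`, `1` or `-1`; moreover it is nonzero if and only if
`V` is isomorphic as a `G`-representation to its twisted dual `V†`, the dual space `V*` with
the action `(g · f)(v) = f(ρ(τ(g⁻¹)) v)`. -/
theorem twisted_second_FS_indicator_of_finite_group
    (G : Type*) [Group G] [Fintype G]
    (τ : MulAut G) (hτ : τ ^ 2 = 1)
    (V : Type*) [AddCommGroup V] [Module ℂ V] [FiniteDimensional ℂ V] [Nontrivial V]
    (ρ : Representation ℂ G V)
    (hirr : ∀ U : Submodule ℂ V, (∀ (g : G) (v : V), v ∈ U → ρ g v ∈ U) → U = ⊥ ∨ U = ⊤) :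
    ((Fintype.card G : ℂ)⁻¹ * ∑ g : G, LinearMap.trace ℂ V (ρ (g * τ g)) = 0 ∨
      (Fintype.card G : ℂ)⁻¹ * ∑ g : G, LinearMap.trace ℂ V (ρ (g * τ g)) = 1 ∨
      (Fintype.card G : ℂ)⁻¹ * ∑ g : G, LinearMap.trace ℂ V (ρ (g * τ g)) = -1) ∧
    ((Fintype.card G : ℂ)⁻¹ * ∑ g : G, LinearMap.trace ℂ V (ρ (g * τ g)) ≠ 0 ↔
      ∃ e : V ≃ₗ[ℂ] Module.Dual ℂ V, ∀ (g : G) (v : V),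
        e (ρ g v) = (ρ (τ g⁻¹)).dualMap (e v)) := by
  have hequiv (e : V ≃ₗ[ℂ] Module.Dual ℂ V) :
      IsTwistedInvariant ρ τ e.toLinearMap ↔
        ∀ (g : G) (v : V), e (ρ g v) = (ρ (τ g⁻¹)).dualMap (e v) :=
    isTwistedInvariant_iff_equivariant ρ τ e.toLinearMap
  simp only [← hequiv]
  by_cases h : ∃ e : V ≃ₗ[ℂ] Module.Dual ℂ V, IsTwistedInvariant ρ τ e.toLinearMap
  · obtain ⟨e, he⟩ := h
    have hone := twisted_indicator_eq_one_or_neg_one hτ hirr he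
    refine ⟨Or.inr hone, fun _ => ⟨e, he⟩, fun _ => ?_⟩
    rcases hone with h1 | h1 <;> rw [h1] <;> norm_num
  · have hzero := not_imp_comm.mp (exists_equiv_of_twisted_indicator_ne_zero hirr) h
    exact ⟨Or.inl hzero, fun hne => absurd hzero hne, fun hex => absurd hex h⟩
end
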